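/- arXiv:1105.5427 — 3 statements merged into one kernel-verified Lean document; each statement's English description precedes it below -/
import Mathlib

section
/- (Excessive gap is maintained by the primal update with simultaneous parameter update.) Let β₁ > 0, β₂ > 0, τ ∈ (0, 1) satisfy β₁β₂ ≥ (2τ²/(1 − τ)²)·max{‖A₁‖²/σ₁, ‖A₂‖²/σ₂}, and let (x̄, ȳ) ∈ X × ℝ^m satisfy f(x̄; β₂) ≤ d(ȳ; β₁). Let x' = (x'₁, x'₂) ∈ X be such that x'ᵢ minimizes xᵢ ↦ φᵢ(xᵢ) + ⟨ȳ, Aᵢxᵢ⟩ + β₁ pᵢ(xᵢ) over Xᵢ for i = 1, 2. Define x̂ := (1 − τ)x̄ + τx', β₁⁺ := (1 − τ)β₁, β₂⁺ := (1 − τ)β₂, ȳ⁺ := (1 − τ)ȳ + τ·(A x̂ − b)/β₂⁺, and let x̄⁺ = (x̄⁺₁, x̄⁺₂) ∈ X be such that x̄⁺ᵢ minimizes xᵢ ↦ φᵢ(xᵢ) + ⟨(A x̂ − b)/β₂⁺, Aᵢ(xᵢ − x̂ᵢ)⟩ + (‖Aᵢ‖²/β₂⁺)·‖xᵢ − x̂ᵢ‖²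 over Xᵢ for i = 1, 2. Then (x̄⁺, ȳ⁺) ∈ X × ℝ^m and f(x̄⁺; β₂⁺) ≤ d(ȳ⁺; β₁⁺). -/
open scoped RealInnerProductSpace


lemma aux_min {E F : Type*} [NormedAddCommGroup E] [InnerProductSpace ℝ E]
    [NormedAddCommGroup F] [InnerProductSpace ℝ F] (X : Set E) (φ p : E → ℝ)
    (hX : Convex ℝ X)
    (hφ : ConvexOn ℝ Set.univ φ) (A : E →L[ℝ] F) (y : F) (σ β : ℝ) (hβ : 0 < β)
    (hp : ConvexOn ℝ X (fun x => p x - σ / 2 * ‖x‖ ^ 2)) (x z : E) (hx : x ∈ X) (hz : z ∈ X)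
    (hmin : ∀ z ∈ X, φ x + ⟪y, A x⟫ + β * p x ≤ φ z + ⟪y, A z⟫ + β * p z) :
    φ x + ⟪y, A x⟫ + β * p x + β * σ / 2 * ‖z - x‖ ^ 2 ≤ φ z + ⟪y, A z⟫ + β * p z := by
  have hsc := strongConvexOn_iff_convex.2 hp
  have key : ∀ t ∈ Set.Ioo (0 : ℝ) 1,
      φ x + ⟪y, A x⟫ + β * p x + (1 - t) * (β * σ / 2 * ‖z - x‖ ^ 2)
        ≤ φ z + ⟪y, A z⟫ + β * p z := by
    intro t ht
    have h1 := hφ.2 (Set.mem_univ x) (Set.mem_univ z) (sub_nonneg.2 ht.2.le) ht.1.le (by ring)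
    have h2 := hsc.2 hx hz (sub_nonneg.2 ht.2.le) ht.1.le (by ring)
    have h3 := hmin _ (hX hx hz (sub_nonneg.2 ht.2.le) ht.1.le (by ring))
    rw [map_add, map_smul, map_smul, inner_add_right, inner_smul_right, inner_smul_right] at h3
    simp only [smul_eq_mul] at h1 h2
    rw [norm_sub_rev x z] at h2
    have h4 := mul_le_mul_of_nonneg_left h2 hβ.le
    have : t * (φ x + ⟪y, A x⟫ + β * p x + (1 - t) * (β * σ / 2 * ‖z - x‖ ^ 2))
        ≤ t * (φ z + ⟪y, A z⟫ + β * p z) := by nlinarith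
    exact le_of_mul_le_mul_left this ht.1
  have hlim : Filter.Tendsto (fun t : ℝ => φ x + ⟪y, A x⟫ + β * p x
      + (1 - t) * (β * σ / 2 * ‖z - x‖ ^ 2)) (nhdsWithin 0 (Set.Ioi 0))
      (nhds (φ x + ⟪y, A x⟫ + β * p x + (1 - 0) * (β * σ / 2 * ‖z - x‖ ^ 2))) := by
    apply Filter.Tendsto.mono_left _ nhdsWithin_le_nhds
    apply Continuous.tendsto
    fun_prop
  have := le_of_tendsto hlim (by
    filter_upwards [Ioo_mem_nhdsGT (zero_lt_one' ℝ)] with t ht using key t ht)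
  simpa using this

lemma aux_comp {E F : Type*} [NormedAddCommGroup E] [InnerProductSpace ℝ E]
    [NormedAddCommGroup F] [InnerProductSpace ℝ F] (X : Set E) (φ p : E → ℝ)
    (hX : Convex ℝ X)
    (hφ : ConvexOn ℝ Set.univ φ) (A : E →L[ℝ] F) (y v : F) (σ β τ B : ℝ) (hβ : 0 < β)
    (hτ : τ ∈ Set.Ioo (0 : ℝ) 1) (hB : 0 < B)
    (hc : τ ^ 2 * (‖A‖ ^ 2 / B) ≤ (1 - τ) * (β * σ / 2))
    (hp : ConvexOn ℝ X (fun x => p x - σ / 2 * ‖x‖ ^ 2)) (x' xb xh xp x : E)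
    (hx' : x' ∈ X) (hxb : xb ∈ X) (hx : x ∈ X)
    (hxh : xh = (1 - τ) • xb + τ • x')
    (hmin : ∀ z ∈ X, φ x' + ⟪y, A x'⟫ + β * p x' ≤ φ z + ⟪y, A z⟫ + β * p z)
    (hmin2 : ∀ z ∈ X, φ xp + ⟪v, A (xp - xh)⟫ + ‖A‖ ^ 2 / B * ‖xp - xh‖ ^ 2
      ≤ φ z + ⟪v, A (z - xh)⟫ + ‖A‖ ^ 2 / B * ‖z - xh‖ ^ 2) :
    φ xp + ⟪v, A (xp - xh)⟫ + ‖A (xp - xh)‖ ^ 2 / B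
      + (1 - τ) * (φ x' + ⟪y, A x'⟫ + β * p x') ≤
    (1 - τ) * φ xb + τ * φ x + τ * (⟪v, A x⟫ - ⟪v, A x'⟫)
      + (1 - τ) * (φ x + ⟪y, A x⟫ + β * p x) := by
  have h1 := aux_min X φ p hX hφ A y σ β hβ hp x' x hx' hx hmin
  have h2 := hmin2 _ (hX hxb hx (sub_nonneg.2 hτ.2.le) hτ.1.le (by ring))
  have h3 := hφ.2 (Set.mem_univ xb) (Set.mem_univ x) (sub_nonneg.2 hτ.2.le) hτ.1.le (by ring)
  have e : (1 - τ) • xb + τ • x - xh = τ • (x - x') := by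
    rw [hxh, smul_sub]; abel
  rw [e, map_smul, inner_smul_right, map_sub A x x', inner_sub_right, norm_smul, mul_pow,
    Real.norm_eq_abs, sq_abs] at h2
  have h4 : ‖A (xp - xh)‖ ^ 2 / B ≤ ‖A‖ ^ 2 / B * ‖xp - xh‖ ^ 2 := by
    rw [div_mul_eq_mul_div, ← mul_pow]
    gcongr
    exact A.le_opNorm _
  have h5 := mul_le_mul_of_nonneg_right hc (sq_nonneg ‖x - x'‖)
  have h6 := mul_le_mul_of_nonneg_left h1 (sub_nonneg.2 hτ.2.le)
  simp only [smul_eq_mul] at h3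
  linarith

lemma aux_const (a σ β₁ β₂ τ M : ℝ) (hσ : 0 < σ) (hβ₂ : 0 < β₂) (hτ : τ ∈ Set.Ioo (0 : ℝ) 1)
    (hM : a / σ ≤ M) (h : β₁ * β₂ ≥ 2 * τ ^ 2 / (1 - τ) ^ 2 * M) :
    τ ^ 2 * (a / ((1 - τ) * β₂)) ≤ (1 - τ) * (β₁ * σ / 2) := by
  have ht : 0 < 1 - τ := sub_pos.2 hτ.2
  have h1 : 2 * τ ^ 2 / (1 - τ) ^ 2 * (a / σ) ≤ β₁ * β₂ :=
    le_trans (mul_le_mul_of_nonneg_left hM (by positivity)) h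
  rw [div_mul_div_comm, div_le_iff₀ (by positivity)] at h1
  rw [← mul_div_assoc, div_le_iff₀ (by positivity)]
  linarith

lemma aux_psi {F : Type*} [NormedAddCommGroup F] [InnerProductSpace ℝ F]
    (h d₁ d₂ : F) (B : ℝ) (hB : 0 < B) :
    ‖h + d₁ + d₂‖ ^ 2 / (2 * B) ≤ ‖h‖ ^ 2 / (2 * B) + ⟪B⁻¹ • h, d₁⟫ + ⟪B⁻¹ • h, d₂⟫
      + ‖d₁‖ ^ 2 / B + ‖d₂‖ ^ 2 / B := by
  have e : ‖h + d₁ + d₂‖ ^ 2 ≤ ‖h‖ ^ 2 + 2 * ⟪h, d₁⟫ + 2 * ⟪h, d₂⟫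
      + 2 * ‖d₁‖ ^ 2 + 2 * ‖d₂‖ ^ 2 := by
    have h1 := norm_sub_sq_real d₁ d₂
    have h2 := sq_nonneg ‖d₁ - d₂‖
    rw [norm_add_sq_real (h + d₁), norm_add_sq_real h, inner_add_left]
    linarith
  rw [div_le_iff₀ (by positivity), real_inner_smul_left, real_inner_smul_left]
  refine e.trans (le_of_eq ?_)
  field_simp

lemma aux_psi2 {F : Type*} [NormedAddCommGroup F] [InnerProductSpace ℝ F]
    (h u w : F) (β τ : ℝ) (hβ : 0 < β) (hτ : τ ∈ Set.Ioo (0 : ℝ) 1)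
    (hh : h = (1 - τ) • u + τ • w) :
    ‖h‖ ^ 2 / (2 * ((1 - τ) * β)) - τ * ⟪((1 - τ) * β)⁻¹ • h, w⟫
      ≤ (1 - τ) * (‖u‖ ^ 2 / (2 * β)) := by
  have ht : 0 < 1 - τ := sub_pos.2 hτ.2
  have e : (1 - τ) • u = h - τ • w := by rw [hh]; abel
  have e2 : (1 - τ) ^ 2 * ‖u‖ ^ 2 = ‖h - τ • w‖ ^ 2 := by
    rw [← e, norm_smul, mul_pow, Real.norm_eq_abs, sq_abs]
  rw [norm_sub_sq_real, inner_smul_right] at e2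
  have e3 := sq_nonneg ‖τ • w‖
  have e4 : (1 - τ) * (‖u‖ ^ 2 / (2 * β)) = ((1 - τ) ^ 2 * ‖u‖ ^ 2) / (2 * ((1 - τ) * β)) := by
    field_simp
  rw [e4, real_inner_smul_left, le_div_iff₀ (by positivity)]
  have e5 : (‖h‖ ^ 2 / (2 * ((1 - τ) * β)) - τ * (((1 - τ) * β)⁻¹ * ⟪h, w⟫))
      * (2 * ((1 - τ) * β)) = ‖h‖ ^ 2 - 2 * (τ * ⟪h, w⟫) := by
    field_simp
  linarith

theorem stmt_6 {m n₁ n₂ : ℕ} (hm : 0 < m) (hn₁ : 0 < n₁) (hn₂ : 0 < n₂)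
    (X1 : Set (EuclideanSpace ℝ (Fin n₁))) (X2 : Set (EuclideanSpace ℝ (Fin n₂)))
    (hX1ne : X1.Nonempty) (hX1cp : IsCompact X1) (hX1cv : Convex ℝ X1)
    (hX2ne : X2.Nonempty) (hX2cp : IsCompact X2) (hX2cv : Convex ℝ X2)
    (φ₁ : EuclideanSpace ℝ (Fin n₁) → ℝ) (φ₂ : EuclideanSpace ℝ (Fin n₂) → ℝ)
    (hφ₁c : Continuous φ₁) (hφ₁cv : ConvexOn ℝ Set.univ φ₁)
    (hφ₂c : Continuous φ₂) (hφ₂cv : ConvexOn ℝ Set.univ φ₂)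
    (A₁ : EuclideanSpace ℝ (Fin n₁) →L[ℝ] EuclideanSpace ℝ (Fin m))
    (A₂ : EuclideanSpace ℝ (Fin n₂) →L[ℝ] EuclideanSpace ℝ (Fin m))
    (b : EuclideanSpace ℝ (Fin m))
    (p₁ : EuclideanSpace ℝ (Fin n₁) → ℝ) (p₂ : EuclideanSpace ℝ (Fin n₂) → ℝ)
    (hp₁c : Continuous p₁) (hp₂c : Continuous p₂)
    (σ₁ σ₂ : ℝ) (hσ₁ : 0 < σ₁) (hσ₂ : 0 < σ₂)
    (hp₁sc : ConvexOn ℝ X1 (fun x => p₁ x - σ₁ / 2 * ‖x‖ ^ 2))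
    (hp₂sc : ConvexOn ℝ X2 (fun x => p₂ x - σ₂ / 2 * ‖x‖ ^ 2))
    (hp₁nn : ∀ x ∈ X1, 0 ≤ p₁ x) (hp₂nn : ∀ x ∈ X2, 0 ≤ p₂ x)
    (dβ : ℝ → EuclideanSpace ℝ (Fin m) → ℝ)
    (hdβ : ∀ β : ℝ, 0 < β → ∀ y, IsLeast
      ((fun x : EuclideanSpace ℝ (Fin n₁) × EuclideanSpace ℝ (Fin n₂) =>
        φ₁ x.1 + φ₂ x.2 + ⟪A₁ x.1 + A₂ x.2 - b, y⟫ + β * (p₁ x.1 + p₂ x.2)) '' (X1 ×ˢ X2))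
      (dβ β y))
    (β₁ β₂ τ : ℝ) (hβ₁ : 0 < β₁) (hβ₂ : 0 < β₂) (hτ : τ ∈ Set.Ioo (0 : ℝ) 1)
    (xb : EuclideanSpace ℝ (Fin n₁) × EuclideanSpace ℝ (Fin n₂))
    (hxb : xb ∈ X1 ×ˢ X2)
    (yb : EuclideanSpace ℝ (Fin m))
    (hgap : φ₁ xb.1 + φ₂ xb.2 + ‖A₁ xb.1 + A₂ xb.2 - b‖ ^ 2 / (2 * β₂) ≤ dβ β₁ yb)
    (hββ : β₁ * β₂ ≥ 2 * τ ^ 2 / (1 - τ) ^ 2 * max (‖A₁‖ ^ 2 / σ₁) (‖A₂‖ ^ 2 / σ₂))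
    (x' : EuclideanSpace ℝ (Fin n₁) × EuclideanSpace ℝ (Fin n₂))
    (hx' : x' ∈ X1 ×ˢ X2)
    (hx'1 : ∀ z ∈ X1, φ₁ x'.1 + ⟪yb, A₁ x'.1⟫ + β₁ * p₁ x'.1 ≤ φ₁ z + ⟪yb, A₁ z⟫ + β₁ * p₁ z)
    (hx'2 : ∀ z ∈ X2, φ₂ x'.2 + ⟪yb, A₂ x'.2⟫ + β₁ * p₂ x'.2 ≤ φ₂ z + ⟪yb, A₂ z⟫ + β₁ * p₂ z)
    (xh : EuclideanSpace ℝ (Fin n₁) × EuclideanSpace ℝ (Fin n₂))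
    (hxh : xh = (1 - τ) • xb + τ • x')
    (ybp : EuclideanSpace ℝ (Fin m))
    (hybp : ybp = (1 - τ) • yb + τ • (((1 - τ) * β₂)⁻¹ • (A₁ xh.1 + A₂ xh.2 - b)))
    (xbp : EuclideanSpace ℝ (Fin n₁) × EuclideanSpace ℝ (Fin n₂))
    (hxbpmem : xbp ∈ X1 ×ˢ X2)
    (hxbp1 : ∀ z ∈ X1,
      φ₁ xbp.1 + ⟪((1 - τ) * β₂)⁻¹ • (A₁ xh.1 + A₂ xh.2 - b), A₁ (xbp.1 - xh.1)⟫
        + ‖A₁‖ ^ 2 / ((1 - τ) * β₂) * ‖xbp.1 - xh.1‖ ^ 2 ≤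
      φ₁ z + ⟪((1 - τ) * β₂)⁻¹ • (A₁ xh.1 + A₂ xh.2 - b), A₁ (z - xh.1)⟫
        + ‖A₁‖ ^ 2 / ((1 - τ) * β₂) * ‖z - xh.1‖ ^ 2)
    (hxbp2 : ∀ z ∈ X2,
      φ₂ xbp.2 + ⟪((1 - τ) * β₂)⁻¹ • (A₁ xh.1 + A₂ xh.2 - b), A₂ (xbp.2 - xh.2)⟫
        + ‖A₂‖ ^ 2 / ((1 - τ) * β₂) * ‖xbp.2 - xh.2‖ ^ 2 ≤
      φ₂ z + ⟪((1 - τ) * β₂)⁻¹ • (A₁ xh.1 + A₂ xh.2 - b), A₂ (z - xh.2)⟫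
        + ‖A₂‖ ^ 2 / ((1 - τ) * β₂) * ‖z - xh.2‖ ^ 2) :
    xbp ∈ X1 ×ˢ X2 ∧
    φ₁ xbp.1 + φ₂ xbp.2 + ‖A₁ xbp.1 + A₂ xbp.2 - b‖ ^ 2 / (2 * ((1 - τ) * β₂)) ≤
      dβ ((1 - τ) * β₁) ybp := by
  refine ⟨hxbpmem, ?_⟩
  have ht : 0 < 1 - τ := sub_pos.2 hτ.2
  have hB : 0 < (1 - τ) * β₂ := by positivity
  obtain ⟨⟨x, hx, hxe⟩, -⟩ := hdβ ((1 - τ) * β₁) (by positivity) ybp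
  have hd := (hdβ β₁ hβ₁ yb).2 ⟨x', hx', rfl⟩
  rw [← hxe]
  have hxh1 : xh.1 = (1 - τ) • xb.1 + τ • x'.1 := by rw [hxh]; rfl
  have hxh2 : xh.2 = (1 - τ) • xb.2 + τ • x'.2 := by rw [hxh]; rfl
  have hh : A₁ xh.1 + A₂ xh.2 - b
      = (1 - τ) • (A₁ xb.1 + A₂ xb.2 - b) + τ • (A₁ x'.1 + A₂ x'.2 - b) := by
    rw [hxh1, hxh2]
    simp only [map_add, map_smul]
    module
  have g2 := aux_psi2 _ _ _ β₂ τ hβ₂ hτ hh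
  have g1 := aux_psi (A₁ xh.1 + A₂ xh.2 - b) (A₁ (xbp.1 - xh.1)) (A₂ (xbp.2 - xh.2)) _ hB
  have e1 : A₁ xh.1 + A₂ xh.2 - b + A₁ (xbp.1 - xh.1) + A₂ (xbp.2 - xh.2)
      = A₁ xbp.1 + A₂ xbp.2 - b := by
    simp only [map_sub]; abel
  rw [e1] at g1
  have c1 := aux_comp X1 φ₁ p₁ hX1cv hφ₁cv A₁ yb _ σ₁ β₁ τ _ hβ₁ hτ hB
    (aux_const _ _ _ _ _ _ hσ₁ hβ₂ hτ (le_max_left _ _) hββ) hp₁sc x'.1 xb.1 xh.1 xbp.1 x.1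
    hx'.1 hxb.1 hx.1 hxh1 hx'1 hxbp1
  have c2 := aux_comp X2 φ₂ p₂ hX2cv hφ₂cv A₂ yb _ σ₂ β₁ τ _ hβ₁ hτ hB
    (aux_const _ _ _ _ _ _ hσ₂ hβ₂ hτ (le_max_right _ _) hββ) hp₂sc x'.2 xb.2 xh.2 xbp.2 x.2
    hx'.2 hxb.2 hx.2 hxh2 hx'2 hxbp2
  have g3 := mul_le_mul_of_nonneg_left (hgap.trans hd) ht.le
  subst hybp
  generalize ((1 - τ) * β₂)⁻¹ • (A₁ xh.1 + A₂ xh.2 - b) = v at *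
  simp only [inner_add_right, inner_smul_right, inner_sub_left, inner_add_left, inner_sub_right,
    real_inner_comm _ yb, real_inner_comm _ v] at *
  linarith
end

section
/- (Convergence rate of the decomposition algorithm with primal update.) Let L̄ := 2·max{‖A₁‖²/σ₁, ‖A₂‖²/σ₂} > 0 and for each integer k ≥ 0 set β₁^k = β₂^k := √L̄/(0.499·k + 1). Suppose {(x̄^k, ȳ^k)} ⊆ X × ℝ^m is a sequence such that f(x̄^k; β₂^k) ≤ d(ȳ^k; β₁^k) for all k ≥ 0 (as holds for the iterates of Algorithm 1), and let y* be a maximizer of d over ℝ^m. Then for all k ≥ 0: φ(x̄^k) − d(ȳ^k) ≤ √L̄·(D₁ + D₂)/(0.499·k + 1) and ‖A x̄^k − b‖ ≤ (√L̄/(0.499·k + 1))·[‖y*‖ + √(‖y*‖² + 2(D₁ + D₂))]. -/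
open scoped RealInnerProductSpace

theorem stmt_10 {m n₁ n₂ : ℕ} (hm : 0 < m) (hn₁ : 0 < n₁) (hn₂ : 0 < n₂)
    (X1 : Set (EuclideanSpace ℝ (Fin n₁))) (X2 : Set (EuclideanSpace ℝ (Fin n₂)))
    (hX1ne : X1.Nonempty) (hX1cp : IsCompact X1) (hX1cv : Convex ℝ X1)
    (hX2ne : X2.Nonempty) (hX2cp : IsCompact X2) (hX2cv : Convex ℝ X2)
    (φ₁ : EuclideanSpace ℝ (Fin n₁) → ℝ) (φ₂ : EuclideanSpace ℝ (Fin n₂) → ℝ)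
    (hφ₁c : Continuous φ₁) (hφ₁cv : ConvexOn ℝ Set.univ φ₁)
    (hφ₂c : Continuous φ₂) (hφ₂cv : ConvexOn ℝ Set.univ φ₂)
    (A₁ : EuclideanSpace ℝ (Fin n₁) →L[ℝ] EuclideanSpace ℝ (Fin m))
    (A₂ : EuclideanSpace ℝ (Fin n₂) →L[ℝ] EuclideanSpace ℝ (Fin m))
    (b : EuclideanSpace ℝ (Fin m))
    (p₁ : EuclideanSpace ℝ (Fin n₁) → ℝ) (p₂ : EuclideanSpace ℝ (Fin n₂) → ℝ)
    (hp₁c : Continuous p₁) (hp₂c : Continuous p₂)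
    (σ₁ σ₂ : ℝ) (hσ₁ : 0 < σ₁) (hσ₂ : 0 < σ₂)
    (hp₁sc : ConvexOn ℝ X1 (fun x => p₁ x - σ₁ / 2 * ‖x‖ ^ 2))
    (hp₂sc : ConvexOn ℝ X2 (fun x => p₂ x - σ₂ / 2 * ‖x‖ ^ 2))
    (D₁ D₂ : ℝ)
    (hp₁b : ∀ x ∈ X1, 0 ≤ p₁ x ∧ p₁ x ≤ D₁)
    (hp₂b : ∀ x ∈ X2, 0 ≤ p₂ x ∧ p₂ x ≤ D₂)
    (d : EuclideanSpace ℝ (Fin m) → ℝ)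
    (hd : ∀ y, IsLeast
      ((fun x : EuclideanSpace ℝ (Fin n₁) × EuclideanSpace ℝ (Fin n₂) =>
        φ₁ x.1 + φ₂ x.2 + ⟪A₁ x.1 + A₂ x.2 - b, y⟫) '' (X1 ×ˢ X2)) (d y))
    (dβ : ℝ → EuclideanSpace ℝ (Fin m) → ℝ)
    (hdβ : ∀ β : ℝ, 0 < β → ∀ y, IsLeast
      ((fun x : EuclideanSpace ℝ (Fin n₁) × EuclideanSpace ℝ (Fin n₂) =>
        φ₁ x.1 + φ₂ x.2 + ⟪A₁ x.1 + A₂ x.2 - b, y⟫ + β * (p₁ x.1 + p₂ x.2)) '' (X1 ×ˢ X2))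
      (dβ β y))
    (L : ℝ) (hL : L = 2 * max (‖A₁‖ ^ 2 / σ₁) (‖A₂‖ ^ 2 / σ₂)) (hLpos : 0 < L)
    (xb : ℕ → EuclideanSpace ℝ (Fin n₁) × EuclideanSpace ℝ (Fin n₂))
    (yb : ℕ → EuclideanSpace ℝ (Fin m))
    (hxbmem : ∀ k, xb k ∈ X1 ×ˢ X2)
    (ys : EuclideanSpace ℝ (Fin m)) (hys : ∀ y, d y ≤ d ys)
    (hgap : ∀ k : ℕ,
      φ₁ (xb k).1 + φ₂ (xb k).2 +
        ‖A₁ (xb k).1 + A₂ (xb k).2 - b‖ ^ 2 / (2 * (Real.sqrt L / (0.499 * k + 1))) ≤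
      dβ (Real.sqrt L / (0.499 * k + 1)) (yb k)) :
    ∀ k : ℕ,
      φ₁ (xb k).1 + φ₂ (xb k).2 - d (yb k) ≤ Real.sqrt L * (D₁ + D₂) / (0.499 * k + 1) ∧
      ‖A₁ (xb k).1 + A₂ (xb k).2 - b‖ ≤
        Real.sqrt L / (0.499 * k + 1) *
          (‖ys‖ + Real.sqrt (‖ys‖ ^ 2 + 2 * (D₁ + D₂))) := by
  intro k
  have hk : (0:ℝ) < 0.499 * (k:ℝ) + 1 := by positivity
  have hβ : 0 < Real.sqrt L / (0.499 * (k:ℝ) + 1) := div_pos (Real.sqrt_pos.mpr hLpos) hk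
  have hg := hgap k
  have e1 : Real.sqrt L * (D₁ + D₂) / (0.499 * (k:ℝ) + 1)
      = Real.sqrt L / (0.499 * (k:ℝ) + 1) * (D₁ + D₂) := by ring
  rw [e1]
  generalize Real.sqrt L / (0.499 * (k:ℝ) + 1) = β at *
  have h1 : dβ β (yb k) ≤ d (yb k) + β * (D₁ + D₂) := by
    obtain ⟨x, hx, hxe⟩ := (hd (yb k)).1
    have h2 := (hdβ β hβ (yb k)).2 ⟨x, hx, rfl⟩
    have h3 : β * (p₁ x.1 + p₂ x.2) ≤ β * (D₁ + D₂) :=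
      mul_le_mul_of_nonneg_left (add_le_add (hp₁b _ hx.1).2 (hp₂b _ hx.2).2) hβ.le
    simp only at h2 hxe
    linarith
  have h4 := (hd ys).2 ⟨xb k, hxbmem k, rfl⟩
  simp only at h4
  have h5 := real_inner_le_norm (A₁ (xb k).1 + A₂ (xb k).2 - b) ys
  have h6 := hys (yb k)
  have hq : 0 ≤ ‖A₁ (xb k).1 + A₂ (xb k).2 - b‖ ^ 2 / (2 * β) := by positivity
  refine ⟨by linarith, ?_⟩
  generalize A₁ (xb k).1 + A₂ (xb k).2 - b = r at *
  have h7 : ‖r‖ ^ 2 / (2 * β) ≤ ‖r‖ * ‖ys‖ + β * (D₁ + D₂) := by linarith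
  rw [div_le_iff₀ (by positivity)] at h7
  have h8 : (‖r‖ / β - ‖ys‖) ^ 2 ≤ ‖ys‖ ^ 2 + 2 * (D₁ + D₂) := by
    have e : ‖r‖ = β * (‖r‖ / β) := by field_simp
    generalize ‖r‖ / β = t at *
    rw [e] at h7
    have : β ^ 2 * (t - ‖ys‖) ^ 2 ≤ β ^ 2 * (‖ys‖ ^ 2 + 2 * (D₁ + D₂)) := by nlinarith
    exact le_of_mul_le_mul_left this (by positivity)
  have h9 := Real.le_sqrt_of_sq_le h8
  have h10 : ‖r‖ / β ≤ ‖ys‖ + Real.sqrt (‖ys‖ ^ 2 + 2 * (D₁ + D₂)) := by linarith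
  rw [div_le_iff₀ hβ] at h10
  linarith
end

section
/- (Excessive gap is maintained by the primal scheme A^p with β₂ fixed.) Let β₁ > 0, β₂ > 0, τ ∈ (0, 1) satisfy β₁β₂ ≥ (2τ²/(1 − τ))·max{‖A₁‖²/σ₁, ‖A₂‖²/σ₂}, and let (x̄, ȳ) ∈ X × ℝ^m satisfy f(x̄; β₂) ≤ d(ȳ; β₁). Let x' = (x'₁, x'₂) ∈ X be such that x'ᵢ minimizes xᵢ ↦ φᵢ(xᵢ) + ⟨ȳ, Aᵢxᵢ⟩ + β₁ pᵢ(xᵢ) over Xᵢ for i = 1, 2. Define x̂ := (1 − τ)x̄ + τx', ȳ⁺ := (1 − τ)ȳ + τ·(A x̂ − b)/β₂, and let x̄⁺ = (x̄⁺₁, x̄⁺₂) ∈ X be such that x̄⁺ᵢ minimizes xᵢ ↦ φᵢ(xᵢ) + ⟨(A x̂ − b)/β₂, Aᵢ(xᵢ − x̂ᵢ)⟩ + (‖Aᵢ‖²/β₂)·‖xᵢ − x̂ᵢ‖² over Xᵢ for i = 1, 2, and set β₁⁺ := (1 − τ)β₁. Then (x̄⁺, ȳ⁺) ∈ X × ℝ^m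 and f(x̄⁺; β₂) ≤ d(ȳ⁺; β₁⁺). -/
open scoped RealInnerProductSpace


lemma strong_min {E : Type*} [NormedAddCommGroup E] [InnerProductSpace ℝ E]
    (X : Set E) (g : E → ℝ) (c : ℝ)
    (hg : ConvexOn ℝ X (fun x => g x - c / 2 * ‖x‖ ^ 2)) (x' : E) (hx' : x' ∈ X)
    (hmin : ∀ z ∈ X, g x' ≤ g z) (x : E) (hx : x ∈ X) :
    g x' + c / 2 * ‖x - x'‖ ^ 2 ≤ g x := by
  have key : ∀ t : ℝ, 0 < t → t < 1 → (1 - t) * (c / 2 * ‖x - x'‖ ^ 2) ≤ g x - g x' := by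
    intro t ht0 ht1
    have h1 := hg.2 hx' hx (by linarith : (0:ℝ) ≤ 1 - t) ht0.le (by ring)
    have h2 := hmin _ (hg.1 hx' hx (by linarith : (0:ℝ) ≤ 1 - t) ht0.le (by ring))
    simp only [smul_eq_mul] at h1
    have h3 : ‖(1 - t) • x' + t • x‖ ^ 2
        = (1 - t) * ‖x'‖ ^ 2 + t * ‖x‖ ^ 2 - t * (1 - t) * ‖x - x'‖ ^ 2 := by
      rw [@norm_add_sq_real, @norm_sub_sq_real, norm_smul, norm_smul, mul_pow, mul_pow,
        Real.norm_eq_abs, Real.norm_eq_abs, sq_abs, sq_abs, real_inner_smul_left,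
        real_inner_smul_right, real_inner_comm x x']
      ring
    rw [h3] at h1
    have h4 : t * ((1 - t) * (c / 2 * ‖x - x'‖ ^ 2)) ≤ t * (g x - g x') := by linarith
    exact le_of_mul_le_mul_left h4 ht0
  have hD := hmin x hx
  by_contra hcon
  push Not at hcon
  set K := c / 2 * ‖x - x'‖ ^ 2 with hK
  have hKpos : 0 < K := by linarith
  have h := key ((K - (g x - g x')) / (2 * K)) (by apply div_pos <;> linarith)
    (by rw [div_lt_one (by linarith)]; linarith)
  have e : (1 - (K - (g x - g x')) / (2 * K)) * K = (K + (g x - g x')) / 2 := by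
    field_simp
    ring
  rw [e] at h
  linarith

/-- One block: growth of the smoothed dual objective around its minimizer. -/
lemma block_growth {E F : Type*} [NormedAddCommGroup E] [InnerProductSpace ℝ E]
    [NormedAddCommGroup F] [InnerProductSpace ℝ F]
    (X : Set E) (φ p : E → ℝ) (A : E →L[ℝ] F) (y : F) (β σ : ℝ) (hβ : 0 < β) (hσ : 0 < σ)
    (hφ : ConvexOn ℝ Set.univ φ) (hp : ConvexOn ℝ X (fun x => p x - σ / 2 * ‖x‖ ^ 2))
    (x' : E) (hx' : x' ∈ X)
    (hmin : ∀ z ∈ X, φ x' + ⟪y, A x'⟫ + β * p x' ≤ φ z + ⟪y, A z⟫ + β * p z)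
    (x : E) (hx : x ∈ X) :
    φ x' + ⟪y, A x'⟫ + β * p x' + β * σ / 2 * ‖x - x'‖ ^ 2 ≤ φ x + ⟪y, A x⟫ + β * p x := by
  refine strong_min X (fun x => φ x + ⟪y, A x⟫ + β * p x) (β * σ) ?_ x' hx' hmin x hx
  refine ⟨hp.1, fun u hu v hv a b ha hb hab => ?_⟩
  have h1 := hp.2 hu hv ha hb hab
  have h2 := hφ.2 (Set.mem_univ u) (Set.mem_univ v) ha hb hab
  have h3 := mul_le_mul_of_nonneg_left h1 hβ.le
  simp only [smul_eq_mul, map_add, map_smul, inner_add_right, real_inner_smul_right] at *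
  linarith

/-- One block: the step from `x` to the minimizer of the upper model. -/
lemma block_step {E F : Type*} [NormedAddCommGroup E] [InnerProductSpace ℝ E]
    [NormedAddCommGroup F] [InnerProductSpace ℝ F]
    (X : Set E) (φ : E → ℝ) (A : E →L[ℝ] F) (u : F) (β₁ β₂ σ τ M : ℝ) (hβ₂ : 0 < β₂)
    (hσ : 0 < σ) (hτ0 : 0 < τ) (hτ1 : τ < 1)
    (hφ : ConvexOn ℝ Set.univ φ) (hX : Convex ℝ X)
    (hM : ‖A‖ ^ 2 / σ ≤ M) (hββ : β₁ * β₂ ≥ 2 * τ ^ 2 / (1 - τ) * M)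
    (xb x' xh xp x : E) (hxb : xb ∈ X) (hx : x ∈ X)
    (hxh : xh = (1 - τ) • xb + τ • x')
    (hmin : ∀ z ∈ X, φ xp + ⟪u, A (xp - xh)⟫ + ‖A‖ ^ 2 / β₂ * ‖xp - xh‖ ^ 2 ≤
      φ z + ⟪u, A (z - xh)⟫ + ‖A‖ ^ 2 / β₂ * ‖z - xh‖ ^ 2) :
    φ xp + ⟪u, A (xp - xh)⟫ + ‖A‖ ^ 2 / β₂ * ‖xp - xh‖ ^ 2 ≤
      (1 - τ) * (φ xb + ⟪u, A xb⟫ + β₁ * σ / 2 * ‖x - x'‖ ^ 2)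
        + τ * (φ x + ⟪u, A x⟫) - ⟪u, A xh⟫ := by
  have h1τ : 0 < 1 - τ := by linarith
  have h1 := hmin _ (hX hxb hx h1τ.le hτ0.le (by ring))
  have h2 := hφ.2 (Set.mem_univ xb) (Set.mem_univ x) h1τ.le hτ0.le (by ring)
  have e : (1 - τ) • xb + τ • x - xh = τ • (x - x') := by rw [hxh, smul_sub]; abel
  have hn : ‖(1 - τ) • xb + τ • x - xh‖ ^ 2 = τ ^ 2 * ‖x - x'‖ ^ 2 := by
    rw [e, norm_smul, mul_pow, Real.norm_eq_abs, sq_abs]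
  rw [hn] at h1
  have h3 : ⟪u, A ((1 - τ) • xb + τ • x - xh)⟫
      = (1 - τ) * ⟪u, A xb⟫ + τ * ⟪u, A x⟫ - ⟪u, A xh⟫ := by
    simp only [map_sub, map_add, map_smul, inner_sub_right, inner_add_right, real_inner_smul_right]
  rw [h3] at h1
  have hc : ‖A‖ ^ 2 / β₂ * τ ^ 2 ≤ (1 - τ) * (β₁ * σ / 2) := by
    have h4 : 2 * τ ^ 2 / (1 - τ) * (‖A‖ ^ 2 / σ) ≤ β₁ * β₂ :=
      le_trans (mul_le_mul_of_nonneg_left hM (by positivity)) hββ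
    rw [div_mul_div_comm, div_le_iff₀ (by positivity)] at h4
    rw [div_mul_eq_mul_div, div_le_iff₀ hβ₂]
    linarith
  have h5 := mul_le_mul_of_nonneg_right hc (sq_nonneg ‖x - x'‖)
  simp only [smul_eq_mul] at h2
  linarith

set_option maxHeartbeats 4000000 in
theorem stmt_11 {m n₁ n₂ : ℕ} (hm : 0 < m) (hn₁ : 0 < n₁) (hn₂ : 0 < n₂)
    (X1 : Set (EuclideanSpace ℝ (Fin n₁))) (X2 : Set (EuclideanSpace ℝ (Fin n₂)))
    (hX1ne : X1.Nonempty) (hX1cp : IsCompact X1) (hX1cv : Convex ℝ X1)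
    (hX2ne : X2.Nonempty) (hX2cp : IsCompact X2) (hX2cv : Convex ℝ X2)
    (φ₁ : EuclideanSpace ℝ (Fin n₁) → ℝ) (φ₂ : EuclideanSpace ℝ (Fin n₂) → ℝ)
    (hφ₁c : Continuous φ₁) (hφ₁cv : ConvexOn ℝ Set.univ φ₁)
    (hφ₂c : Continuous φ₂) (hφ₂cv : ConvexOn ℝ Set.univ φ₂)
    (A₁ : EuclideanSpace ℝ (Fin n₁) →L[ℝ] EuclideanSpace ℝ (Fin m))
    (A₂ : EuclideanSpace ℝ (Fin n₂) →L[ℝ] EuclideanSpace ℝ (Fin m))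
    (b : EuclideanSpace ℝ (Fin m))
    (p₁ : EuclideanSpace ℝ (Fin n₁) → ℝ) (p₂ : EuclideanSpace ℝ (Fin n₂) → ℝ)
    (hp₁c : Continuous p₁) (hp₂c : Continuous p₂)
    (σ₁ σ₂ : ℝ) (hσ₁ : 0 < σ₁) (hσ₂ : 0 < σ₂)
    (hp₁sc : ConvexOn ℝ X1 (fun x => p₁ x - σ₁ / 2 * ‖x‖ ^ 2))
    (hp₂sc : ConvexOn ℝ X2 (fun x => p₂ x - σ₂ / 2 * ‖x‖ ^ 2))
    (hp₁nn : ∀ x ∈ X1, 0 ≤ p₁ x) (hp₂nn : ∀ x ∈ X2, 0 ≤ p₂ x)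
    (dβ : ℝ → EuclideanSpace ℝ (Fin m) → ℝ)
    (hdβ : ∀ β : ℝ, 0 < β → ∀ y, IsLeast
      ((fun x : EuclideanSpace ℝ (Fin n₁) × EuclideanSpace ℝ (Fin n₂) =>
        φ₁ x.1 + φ₂ x.2 + ⟪A₁ x.1 + A₂ x.2 - b, y⟫ + β * (p₁ x.1 + p₂ x.2)) '' (X1 ×ˢ X2))
      (dβ β y))
    (β₁ β₂ τ : ℝ) (hβ₁ : 0 < β₁) (hβ₂ : 0 < β₂) (hτ : τ ∈ Set.Ioo (0 : ℝ) 1)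
    (xb : EuclideanSpace ℝ (Fin n₁) × EuclideanSpace ℝ (Fin n₂))
    (hxb : xb ∈ X1 ×ˢ X2)
    (yb : EuclideanSpace ℝ (Fin m))
    (hgap : φ₁ xb.1 + φ₂ xb.2 + ‖A₁ xb.1 + A₂ xb.2 - b‖ ^ 2 / (2 * β₂) ≤ dβ β₁ yb)
    (hββ : β₁ * β₂ ≥ 2 * τ ^ 2 / (1 - τ) * max (‖A₁‖ ^ 2 / σ₁) (‖A₂‖ ^ 2 / σ₂))
    (x' : EuclideanSpace ℝ (Fin n₁) × EuclideanSpace ℝ (Fin n₂))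
    (hx' : x' ∈ X1 ×ˢ X2)
    (hx'1 : ∀ z ∈ X1, φ₁ x'.1 + ⟪yb, A₁ x'.1⟫ + β₁ * p₁ x'.1 ≤ φ₁ z + ⟪yb, A₁ z⟫ + β₁ * p₁ z)
    (hx'2 : ∀ z ∈ X2, φ₂ x'.2 + ⟪yb, A₂ x'.2⟫ + β₁ * p₂ x'.2 ≤ φ₂ z + ⟪yb, A₂ z⟫ + β₁ * p₂ z)
    (xh : EuclideanSpace ℝ (Fin n₁) × EuclideanSpace ℝ (Fin n₂))
    (hxh : xh = (1 - τ) • xb + τ • x')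
    (ybp : EuclideanSpace ℝ (Fin m))
    (hybp : ybp = (1 - τ) • yb + τ • (β₂⁻¹ • (A₁ xh.1 + A₂ xh.2 - b)))
    (xbp : EuclideanSpace ℝ (Fin n₁) × EuclideanSpace ℝ (Fin n₂))
    (hxbpmem : xbp ∈ X1 ×ˢ X2)
    (hxbp1 : ∀ z ∈ X1,
      φ₁ xbp.1 + ⟪β₂⁻¹ • (A₁ xh.1 + A₂ xh.2 - b), A₁ (xbp.1 - xh.1)⟫
        + ‖A₁‖ ^ 2 / β₂ * ‖xbp.1 - xh.1‖ ^ 2 ≤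
      φ₁ z + ⟪β₂⁻¹ • (A₁ xh.1 + A₂ xh.2 - b), A₁ (z - xh.1)⟫
        + ‖A₁‖ ^ 2 / β₂ * ‖z - xh.1‖ ^ 2)
    (hxbp2 : ∀ z ∈ X2,
      φ₂ xbp.2 + ⟪β₂⁻¹ • (A₁ xh.1 + A₂ xh.2 - b), A₂ (xbp.2 - xh.2)⟫
        + ‖A₂‖ ^ 2 / β₂ * ‖xbp.2 - xh.2‖ ^ 2 ≤
      φ₂ z + ⟪β₂⁻¹ • (A₁ xh.1 + A₂ xh.2 - b), A₂ (z - xh.2)⟫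
        + ‖A₂‖ ^ 2 / β₂ * ‖z - xh.2‖ ^ 2) :
    xbp ∈ X1 ×ˢ X2 ∧
    φ₁ xbp.1 + φ₂ xbp.2 + ‖A₁ xbp.1 + A₂ xbp.2 - b‖ ^ 2 / (2 * β₂) ≤
      dβ ((1 - τ) * β₁) ybp := by
  refine ⟨hxbpmem, ?_⟩
  obtain ⟨hτ0, hτ1⟩ := hτ
  have h1τ : 0 < 1 - τ := by linarith
  obtain ⟨⟨x, hx, hxe⟩, -⟩ := hdβ ((1 - τ) * β₁) (by positivity) ybp
  have hd := (hdβ β₁ hβ₁ yb).2 ⟨x', hx', rfl⟩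
  rw [← hxe]
  have g1 := block_growth X1 φ₁ p₁ A₁ yb β₁ σ₁ hβ₁ hσ₁ hφ₁cv hp₁sc x'.1 hx'.1 hx'1 x.1 hx.1
  have g2 := block_growth X2 φ₂ p₂ A₂ yb β₁ σ₂ hβ₁ hσ₂ hφ₂cv hp₂sc x'.2 hx'.2 hx'2 x.2 hx.2
  have s1 := block_step X1 φ₁ A₁ _ β₁ β₂ σ₁ τ _ hβ₂ hσ₁ hτ0 hτ1 hφ₁cv hX1cv
    (le_max_left _ _) hββ xb.1 x'.1 xh.1 xbp.1 x.1 hxb.1 hx.1 (by rw [hxh]; rfl) hxbp1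
  have s2 := block_step X2 φ₂ A₂ _ β₁ β₂ σ₂ τ _ hβ₂ hσ₂ hτ0 hτ1 hφ₂cv hX2cv
    (le_max_right _ _) hββ xb.2 x'.2 xh.2 xbp.2 x.2 hxb.2 hx.2 (by rw [hxh]; rfl) hxbp2
  set r := A₁ xh.1 + A₂ xh.2 - b with hr
  -- convexity of the square at `xb`
  have q1 : ‖r‖ ^ 2 / (2 * β₂) + β₂⁻¹ * ⟪r, A₁ xb.1 + A₂ xb.2 - b - r⟫
      ≤ ‖A₁ xb.1 + A₂ xb.2 - b‖ ^ 2 / (2 * β₂) := by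
    have h0 := @norm_add_sq_real _ _ _ r (A₁ xb.1 + A₂ xb.2 - b - r)
    rw [add_sub_cancel] at h0
    rw [h0]
    have : 0 ≤ ‖A₁ xb.1 + A₂ xb.2 - b - r‖ ^ 2 / (2 * β₂) := by positivity
    have e : ∀ a c d : ℝ, (a + 2 * c + d) / (2 * β₂) = a / (2 * β₂) + β₂⁻¹ * c + d / (2 * β₂) := by
      intros; field_simp
    rw [e]; linarith
  -- upper bound of the square at `xbp`
  have q2 : ‖A₁ xbp.1 + A₂ xbp.2 - b‖ ^ 2 / (2 * β₂) ≤
      ‖r‖ ^ 2 / (2 * β₂) + β₂⁻¹ * ⟪r, A₁ (xbp.1 - xh.1) + A₂ (xbp.2 - xh.2)⟫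
      + ‖A₁‖ ^ 2 / β₂ * ‖xbp.1 - xh.1‖ ^ 2 + ‖A₂‖ ^ 2 / β₂ * ‖xbp.2 - xh.2‖ ^ 2 := by
    have e0 : A₁ xbp.1 + A₂ xbp.2 - b = r + (A₁ (xbp.1 - xh.1) + A₂ (xbp.2 - xh.2)) := by
      rw [hr, map_sub, map_sub]; abel
    rw [e0, @norm_add_sq_real]
    have n1 := A₁.le_opNorm (xbp.1 - xh.1)
    have n2 := A₂.le_opNorm (xbp.2 - xh.2)
    have n3 := norm_add_le (A₁ (xbp.1 - xh.1)) (A₂ (xbp.2 - xh.2))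
    have n4 : ‖A₁ (xbp.1 - xh.1) + A₂ (xbp.2 - xh.2)‖ ^ 2
        ≤ (‖A₁‖ * ‖xbp.1 - xh.1‖ + ‖A₂‖ * ‖xbp.2 - xh.2‖) ^ 2 :=
      pow_le_pow_left₀ (norm_nonneg _) (by linarith) 2
    have n5 : ‖A₁ (xbp.1 - xh.1) + A₂ (xbp.2 - xh.2)‖ ^ 2
        ≤ 2 * (‖A₁‖ ^ 2 * ‖xbp.1 - xh.1‖ ^ 2 + ‖A₂‖ ^ 2 * ‖xbp.2 - xh.2‖ ^ 2) := by
      nlinarith [sq_nonneg (‖A₁‖ * ‖xbp.1 - xh.1‖ - ‖A₂‖ * ‖xbp.2 - xh.2‖)]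
    have n6 := div_le_div_of_nonneg_right n5 (by positivity : 0 ≤ 2 * β₂)
    have e : ∀ a c d : ℝ, (a + 2 * c + d) / (2 * β₂) = a / (2 * β₂) + β₂⁻¹ * c + d / (2 * β₂) := by
      intros; field_simp
    have e' : ∀ a c d k : ℝ, 2 * (a * c + d * k) / (2 * β₂) = a / β₂ * c + d / β₂ * k := by
      intros; field_simp
    rw [e' ] at n6
    rw [e]; linarith
  have q3 : 0 ≤ ‖r‖ ^ 2 / (2 * β₂) := by positivity
  have q4 : β₂⁻¹ * ⟪r, r⟫ = 2 * (‖r‖ ^ 2 / (2 * β₂)) := by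
    rw [real_inner_self_eq_norm_sq]; field_simp
  rw [← real_inner_smul_left] at q1 q2 q4
  set u := β₂⁻¹ • r with hu
  have q5 : ⟪u, r⟫ = ⟪u, A₁ xh.1⟫ + ⟪u, A₂ xh.2⟫ - ⟪u, b⟫ := by
    rw [hr, inner_sub_right, inner_add_right]
  rw [inner_sub_right, inner_sub_right, inner_add_right] at q1
  rw [inner_add_right] at q2
  have hd' : dβ β₁ yb ≤ φ₁ x'.1 + φ₂ x'.2 + (⟪yb, A₁ x'.1⟫ + ⟪yb, A₂ x'.2⟫ - ⟪yb, b⟫)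
      + β₁ * (p₁ x'.1 + p₂ x'.2) := by
    rw [← inner_add_right, ← inner_sub_right, real_inner_comm]
    exact hd
  have eG : ⟪A₁ x.1 + A₂ x.2 - b, ybp⟫ = (1 - τ) * (⟪yb, A₁ x.1⟫ + ⟪yb, A₂ x.2⟫ - ⟪yb, b⟫)
      + τ * (⟪u, A₁ x.1⟫ + ⟪u, A₂ x.2⟫ - ⟪u, b⟫) := by
    rw [hybp, inner_add_right, real_inner_smul_right, real_inner_smul_right,
      ← inner_add_right, ← inner_sub_right, real_inner_comm, ← inner_add_right, ← inner_sub_right,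
      real_inner_comm u]
  have m2 := mul_nonneg hτ0.le q3
  show _ ≤ φ₁ x.1 + φ₂ x.2 + ⟪A₁ x.1 + A₂ x.2 - b, ybp⟫ + (1 - τ) * β₁ * (p₁ x.1 + p₂ x.2)
  rw [eG]
  clear_value u r
  have m : φ₁ xb.1 + φ₂ xb.2 + (⟪u, A₁ xb.1⟫ + ⟪u, A₂ xb.2⟫ - ⟪u, b⟫ - ‖r‖ ^ 2 / (2 * β₂))
      + β₁ * σ₁ / 2 * ‖x.1 - x'.1‖ ^ 2 + β₁ * σ₂ / 2 * ‖x.2 - x'.2‖ ^ 2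
      ≤ φ₁ x.1 + φ₂ x.2 + (⟪yb, A₁ x.1⟫ + ⟪yb, A₂ x.2⟫ - ⟪yb, b⟫)
      + β₁ * (p₁ x.1 + p₂ x.2) := by
    linarith
  have m1 := mul_le_mul_of_nonneg_left m h1τ.le
  linarith
end
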